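/- There is a sequence (B_n)_{n ∈ ℕ} of Boolean subalgebras of P(ω)/fin such that for every n: B_{n+1} is a subalgebra of B_n, and there is no Boolean algebra embedding of B_n into B_{n+1}. -/

import Mathlib

open Filter

/-- `P(ω)/fin`: the quotient of the Boolean algebra of all subsets of `ℕ`
(viewed as functions `ℕ → Prop`, i.e. `Set ℕ`) by the equivalence
`A ~ B` iff the symmetric difference of `A` and `B` is finite, i.e. iff
`A` and `B` agree on a cofinite set of coordinates. -/
abbrev PowModFin : Type := Filter.Germ (Filter.cofinite : Filter ℕ) Prop

instance : ComplementedLattice PowModFin := by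
  constructor
  intro a
  induction a using Filter.Germ.inductionOn with
  | _ f =>
    refine ⟨(↑(fun n => (f n)ᶜ) : PowModFin), IsCompl.of_eq ?_ ?_⟩
    · show (↑(fun n => f n ⊓ (f n)ᶜ) : PowModFin) = ⊥
      have : (fun n => f n ⊓ (f n)ᶜ) = fun _ : ℕ => (⊥ : Prop) := by
        funext n; simp
      rw [this]; rfl
    · show (↑(fun n => f n ⊔ (f n)ᶜ) : PowModFin) = ⊤
      have : (fun n => f n ⊔ (f n)ᶜ) = fun _ : ℕ => (⊤ : Prop) := by
        funext n; simp; exact em _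
      rw [this]; rfl

noncomputable instance : BooleanAlgebra PowModFin :=
  DistribLattice.booleanAlgebraOfComplemented _

/-- A subset of `P(ω)/fin` is a (Boolean) subalgebra if it contains `⊥` and `⊤`
and is closed under `⊓`, `⊔` and complementation. -/
def IsBoolSubalgebra (S : Set PowModFin) : Prop :=
  ⊥ ∈ S ∧ ⊤ ∈ S ∧ (∀ a ∈ S, ∀ b ∈ S, a ⊓ b ∈ S) ∧
    (∀ a ∈ S, ∀ b ∈ S, a ⊔ b ∈ S) ∧ (∀ a ∈ S, aᶜ ∈ S)

/-- The Boolean algebra (subalgebra) `S` embeds into the subalgebra `T`: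
there is a map, injective on `S` and mapping `S` into `T`, which preserves
`⊓`, `⊔`, complement, `⊥` and `⊤` (the operations of the subalgebras being
those induced from `P(ω)/fin`). -/
def BAEmbeds (S T : Set PowModFin) : Prop :=
  ∃ f : PowModFin → PowModFin, Set.MapsTo f S T ∧ Set.InjOn f S ∧
    f ⊥ = ⊥ ∧ f ⊤ = ⊤ ∧
    (∀ a ∈ S, ∀ b ∈ S, f (a ⊓ b) = f a ⊓ f b) ∧
    (∀ a ∈ S, ∀ b ∈ S, f (a ⊔ b) = f a ⊔ f b) ∧
    (∀ a ∈ S, f aᶜ = (f a)ᶜ)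

section

open Cardinal Set

/-- A set of rationals is cut by `F` if membership of `s` depends only on the position of `s`
relative to the points of `F`, that is, if it is a finite union of intervals `[x, y)` with
endpoints in `F ∪ {-∞, ∞}`. -/
def IsCutBy (F : Finset ℝ) (S : Set ℚ) : Prop :=
  ∀ s t : ℚ, (∀ x ∈ F, (s : ℝ) < x ↔ (t : ℝ) < x) → (s ∈ S ↔ t ∈ S)

/-- The interval algebra on the rationals with endpoints in `X`. -/
def intervalAlg (X : Set ℝ) : Set (Set ℚ) :=
  {S | ∃ F : Finset ℝ, (F : Set ℝ) ⊆ X ∧ IsCutBy F S}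

/-- The rationals below a real number. -/
def lowerCut (x : ℝ) : Set ℚ := {q | (q : ℝ) < x}

theorem IsCutBy.mono {F G : Finset ℝ} {S : Set ℚ} (h : IsCutBy F S) (hFG : F ⊆ G) :
    IsCutBy G S :=
  fun s t hst => h s t fun x hx => hst x (hFG hx)

theorem IsCutBy.inter {F : Finset ℝ} {S T : Set ℚ} (hS : IsCutBy F S) (hT : IsCutBy F T) :
    IsCutBy F (S ∩ T) :=
  fun s t h => and_congr (hS s t h) (hT s t h)

theorem IsCutBy.union {F : Finset ℝ} {S T : Set ℚ} (hS : IsCutBy F S) (hT : IsCutBy F T) :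
    IsCutBy F (S ∪ T) :=
  fun s t h => or_congr (hS s t h) (hT s t h)

theorem IsCutBy.compl {F : Finset ℝ} {S : Set ℚ} (hS : IsCutBy F S) : IsCutBy F Sᶜ :=
  fun s t h => not_congr (hS s t h)

theorem lowerCut_mem_intervalAlg {X : Set ℝ} {x : ℝ} (hx : x ∈ X) :
    lowerCut x ∈ intervalAlg X :=
  ⟨{x}, by simpa using hx, fun _ _ h => h x (by simp)⟩

theorem intervalAlg_mono {X Y : Set ℝ} (h : X ⊆ Y) : intervalAlg X ⊆ intervalAlg Y :=
  fun _ ⟨F, hF, hS⟩ => ⟨F, hF.trans h, hS⟩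

theorem exists_common_cut {X : Set ℝ} {S T : Set ℚ} (hS : S ∈ intervalAlg X)
    (hT : T ∈ intervalAlg X) :
    ∃ F : Finset ℝ, (F : Set ℝ) ⊆ X ∧ IsCutBy F S ∧ IsCutBy F T := by
  classical
  obtain ⟨F, hF, hS⟩ := hS
  obtain ⟨G, hG, hT⟩ := hT
  exact ⟨F ∪ G, by simp [hF, hG], hS.mono Finset.subset_union_left,
    hT.mono Finset.subset_union_right⟩

theorem inter_mem_intervalAlg {X : Set ℝ} {S T : Set ℚ} (hS : S ∈ intervalAlg X)
    (hT : T ∈ intervalAlg X) : S ∩ T ∈ intervalAlg X := by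
  obtain ⟨F, hF, h1, h2⟩ := exists_common_cut hS hT
  exact ⟨F, hF, h1.inter h2⟩

theorem union_mem_intervalAlg {X : Set ℝ} {S T : Set ℚ} (hS : S ∈ intervalAlg X)
    (hT : T ∈ intervalAlg X) : S ∪ T ∈ intervalAlg X := by
  obtain ⟨F, hF, h1, h2⟩ := exists_common_cut hS hT
  exact ⟨F, hF, h1.union h2⟩

theorem compl_mem_intervalAlg {X : Set ℝ} {S : Set ℚ} (hS : S ∈ intervalAlg X) :
    Sᶜ ∈ intervalAlg X := by
  obtain ⟨F, hF, h⟩ := hS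
  exact ⟨F, hF, h.compl⟩

theorem exists_Ioo_disjoint (G : Finset ℝ) {y : ℝ} (hy : y ∉ G) :
    ∃ a b : ℝ, a < y ∧ y < b ∧ ∀ x ∈ G, x ≤ a ∨ b ≤ x := by
  have hn : (↑G : Set ℝ)ᶜ ∈ nhds y :=
    G.finite_toSet.isClosed.isOpen_compl.mem_nhds (by simpa using hy)
  obtain ⟨a, b, hab, h⟩ := mem_nhds_iff_exists_Ioo_subset.1 hn
  refine ⟨a, b, hab.1, hab.2, fun x hx => ?_⟩
  by_contra! hc
  exact h ⟨hc.1, hc.2⟩ hx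

theorem IsCutBy.infinite_of_nonempty {F : Finset ℝ} {S : Set ℚ} (h : IsCutBy F S)
    (hne : S.Nonempty) : S.Infinite := by
  classical
  obtain ⟨s, hs⟩ := hne
  obtain ⟨a, b, ha, hb, hF⟩ := exists_Ioo_disjoint (F.erase (s : ℝ)) (Finset.notMem_erase _ _)
  obtain ⟨r, hsr, hrb⟩ := exists_rat_btwn hb
  refine (Set.Ioo_infinite (a := s) (b := r) (by exact_mod_cast hsr)).mono fun t ht => ?_
  have h1 : (s : ℝ) < t := by exact_mod_cast ht.1
  have h2 : (t : ℝ) < r := by exact_mod_cast ht.2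
  refine (h s t fun x hx => ?_).1 hs
  by_cases hxs : x = s
  · subst hxs
    simp [ht.1.le]
  · rcases hF x (Finset.mem_erase.2 ⟨hxs, hx⟩) with h3 | h3
    · constructor <;> intro <;> linarith
    · constructor <;> intro <;> linarith

theorem eq_of_finite_symmDiff {X : Set ℝ} {S T : Set ℚ} (hS : S ∈ intervalAlg X)
    (hT : T ∈ intervalAlg X) (hfin : {q | ¬ (q ∈ S ↔ q ∈ T)}.Finite) : S = T := by
  obtain ⟨F, -, h1, h2⟩ := exists_common_cut hS hT
  have hcut : IsCutBy F {q | ¬ (q ∈ S ↔ q ∈ T)} := fun s t h =>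
    not_congr (iff_congr (h1 s t h) (h2 s t h))
  ext q
  by_contra hq
  exact hcut.infinite_of_nonempty ⟨q, hq⟩ hfin

/-- A cut point `y` that can be avoided by some other set of cut points is superfluous. -/
theorem IsCutBy.erase {F G : Finset ℝ} {S : Set ℚ} {y : ℝ} (hF : IsCutBy F S)
    (hG : IsCutBy G S) (hy : y ∉ G) [DecidableEq ℝ] : IsCutBy (F.erase y) S := by
  obtain ⟨a, b, ha, hb, hab⟩ := exists_Ioo_disjoint G hy
  have key : ∀ s t : ℚ, (s : ℝ) < y → y ≤ t →
      (∀ x ∈ F.erase y, (s : ℝ) < x ↔ (t : ℝ) < x) → (s ∈ S ↔ t ∈ S) := by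
    intro s t hs ht hst
    obtain ⟨s', h1, h2, h3⟩ : ∃ s' : ℚ, (s : ℝ) ≤ s' ∧ (s' : ℝ) < y ∧ a < s' := by
      obtain ⟨r, hr1, hr2⟩ := exists_rat_btwn (max_lt hs ha)
      exact ⟨r, ((le_max_left _ _).trans_lt hr1).le, hr2, (le_max_right _ _).trans_lt hr1⟩
    obtain ⟨t', h4, h5, h6⟩ : ∃ t' : ℚ, (t' : ℝ) ≤ t ∧ y ≤ t' ∧ (t' : ℝ) < b := by
      by_cases htb : (t : ℝ) < b
      · exact ⟨t, le_rfl, ht, htb⟩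
      · obtain ⟨r, hr1, hr2⟩ := exists_rat_btwn hb
        exact ⟨r, by linarith, hr1.le, hr2⟩
    have e1 : s ∈ S ↔ s' ∈ S := hF s s' fun x hx => by
      by_cases hxy : x = y
      · simp [hxy, hs, h2]
      · have := hst x (Finset.mem_erase.2 ⟨hxy, hx⟩)
        exact ⟨fun h => by linarith [this.1 h], fun h => by linarith⟩
    have e2 : t' ∈ S ↔ t ∈ S := hF t' t fun x hx => by
      by_cases hxy : x = y
      · simp [hxy, ht.not_gt, h5.not_gt]
      · have := hst x (Finset.mem_erase.2 ⟨hxy, hx⟩)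
        exact ⟨fun h => this.1 (by linarith), fun h => by linarith⟩
    have e3 : s' ∈ S ↔ t' ∈ S := hG s' t' fun x hx => by
      rcases hab x hx with h | h <;> constructor <;> intro <;> linarith
    exact e1.trans (e3.trans e2)
  intro s t hst
  rcases lt_or_ge (s : ℝ) y with hs | hs <;> rcases lt_or_ge (t : ℝ) y with ht | ht
  · refine hF s t fun x hx => ?_
    by_cases hxy : x = y
    · simp [hxy, hs, ht]
    · exact hst x (Finset.mem_erase.2 ⟨hxy, hx⟩)
  · exact key s t hs ht hst
  · exact (key t s ht hs fun x hx => (hst x hx).symm).symm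
  · refine hF s t fun x hx => ?_
    by_cases hxy : x = y
    · simp [hxy, hs.not_gt, ht.not_gt]
    · exact hst x (Finset.mem_erase.2 ⟨hxy, hx⟩)

/-- The points that occur in every finite set of cut points of `S`. -/
def cutSupport (S : Set ℚ) : Set ℝ := {y | ∀ F : Finset ℝ, IsCutBy F S → y ∈ F}

theorem exists_cutSupport_notMem {S : Set ℚ} {P : Set ℝ} (hS : S ∈ intervalAlg univ)
    (hP : S ∉ intervalAlg P) : ∃ y ∈ cutSupport S, y ∉ P := by
  classical
  obtain ⟨F₀, -, h₀⟩ := hS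
  obtain ⟨F, hF, hmin⟩ := exists_minimal_of_wellFoundedLT (IsCutBy · S) ⟨F₀, h₀⟩
  obtain ⟨y, hyF, hyP⟩ := not_subset.1 fun h : (F : Set ℝ) ⊆ P => hP ⟨F, h, hF⟩
  refine ⟨y, fun G hG => ?_, hyP⟩
  by_contra hyG
  exact Finset.notMem_erase y F (hmin (hF.erase hG hyG) (Finset.erase_subset _ _) hyF)

theorem mk_intervalAlg_le (P : Set ℝ) [Infinite P] : #(intervalAlg P) ≤ #P := by
  classical
  let enc : Finset (Finset P) × Finset P → Set ℚ := fun p =>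
    {s | p.2.filter (fun x : P => (s : ℝ) < x) ∈ p.1}
  have hsub : intervalAlg P ⊆ range enc := by
    rintro S ⟨F, hFP, hF⟩
    let F' : Finset P := F.subtype (· ∈ P)
    refine ⟨(F'.powerset.filter (fun A => ∃ s ∈ S, F'.filter (fun x : P => (s : ℝ) < x) = A), F'),
      ?_⟩
    ext t
    simp only [enc, mem_ofPred_eq, Finset.mem_filter, Finset.mem_powerset, Finset.filter_subset,
      true_and]
    refine ⟨fun ⟨s, hs, hst⟩ => (hF s t fun x hx => ?_).1 hs, fun ht => ⟨t, ht, rfl⟩⟩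
    have := congrArg (fun A : Finset P => (⟨x, hFP hx⟩ : P) ∈ A) hst
    simpa [F', hx] using this
  calc #(intervalAlg P) ≤ #(range enc) := mk_le_mk_of_subset hsub
    _ ≤ #(Finset (Finset P) × Finset P) := mk_range_le
    _ = #P := by
      rw [mk_prod, lift_id, lift_id, mk_finset_of_infinite, mk_finset_of_infinite]
      exact mul_eq_self (aleph0_le_mk P)

/-- Transfinite recursion of length at most the continuum, in which the points chosen at each
stage avoid a given small set and everything chosen before. -/
theorem exists_diagonal_choice {J : Type} (hJ : #J ≤ 𝔠) (R : J → ℝ → ℝ → Prop) (D : Set ℝ)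
    (hD : #D < 𝔠) (hR : ∀ j, ∀ P : Set ℝ, #P < 𝔠 → ∃ x y, x ∉ P ∧ y ∉ P ∧ R j x y) :
    ∃ x y : J → ℝ, (∀ j, R j (x j) (y j)) ∧ (∀ j, x j ∉ D) ∧ (∀ j, y j ∉ D) ∧
      Function.Injective x ∧ ∀ j k, k ≠ j → x k ≠ y j := by
  obtain ⟨i⟩ : Nonempty (J ↪ (𝔠).ord.ToType) := by
    rw [← Cardinal.le_def]; simpa using hJ
  have wf : WellFounded fun k j => i k < i j := InvImage.wf i wellFounded_lt
  let past : (j : J) → ((k : J) → i k < i j → ℝ × ℝ) → Set ℝ := fun j z =>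
    D ∪ ((range fun k : {k // i k < i j} => (z k k.2).1) ∪
      range fun k : {k // i k < i j} => (z k k.2).2)
  have hpast : ∀ j z, #(past j z) < 𝔠 := by
    intro j z
    have hlt : #{k // i k < i j} < 𝔠 := by
      refine lt_of_le_of_lt (mk_le_of_injective (β := Iio (i j))
        (f := fun k : {k // i k < i j} => ⟨i k, k.2⟩) fun a b h => ?_)
        (by simpa using mk_Iio_lt (i j) (by simp))
      exact Subtype.ext (i.injective (congrArg Subtype.val h))
    refine (mk_union_le _ _).trans_lt (add_lt_of_lt aleph0_le_continuum hD ?_)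
    exact (mk_union_le _ _).trans_lt (add_lt_of_lt aleph0_le_continuum
      (mk_range_le.trans_lt hlt) (mk_range_le.trans_lt hlt))
  choose X Y hX hY hXY using fun j z => hR j (past j z) (hpast j z)
  let z : J → ℝ × ℝ := wf.fix fun j z => (X j z, Y j z)
  have hz : ∀ j, z j = (X j fun k _ => z k, Y j fun k _ => z k) := fun j => wf.fix_eq _ j
  have hx : ∀ j, (z j).1 ∉ past j fun k _ => z k := fun j => by rw [hz j]; exact hX _ _
  have hy : ∀ j, (z j).2 ∉ past j fun k _ => z k := fun j => by rw [hz j]; exact hY _ _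
  have hm1 : ∀ {k j}, i k < i j → (z k).1 ∈ past j fun k _ => z k :=
    fun {k j} h => Or.inr (Or.inl ⟨⟨k, h⟩, rfl⟩)
  have hm2 : ∀ {k j}, i k < i j → (z k).2 ∈ past j fun k _ => z k :=
    fun {k j} h => Or.inr (Or.inr ⟨⟨k, h⟩, rfl⟩)
  refine ⟨fun j => (z j).1, fun j => (z j).2, fun j => ?_, fun j h => hx j (Or.inl h),
    fun j h => hy j (Or.inl h), fun j k h => ?_, fun j k hkj h => ?_⟩
  · change R j (z j).1 (z j).2
    rw [hz j]; exact hXY _ _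
  · change (z j).1 = (z k).1 at h
    by_contra hne
    rcases lt_or_gt_of_ne (i.injective.ne hne) with hlt | hlt
    · exact hx k (h ▸ hm1 hlt)
    · exact hx j (h ▸ hm1 hlt)
  · change (z k).1 = (z j).2 at h
    rcases lt_or_gt_of_ne (i.injective.ne hkj) with hlt | hlt
    · exact hy j (h ▸ hm1 hlt)
    · exact hx k (h ▸ hm2 hlt)

/-- The left limit at `x` of an increasing family of sets indexed by the rationals. -/
def leftLimit (g : ℚ → Set ℚ) (x : ℝ) : Set ℚ := {r | ∃ q : ℚ, (q : ℝ) < x ∧ r ∈ g q}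

theorem countable_ne_leftLimit {X : Set ℝ} (hX : range ((↑) : ℚ → ℝ) ⊆ X) {T : ℝ → Set ℚ}
    (hT : MonotoneOn T X) : {x ∈ X | T x ≠ leftLimit (fun q => T q) x}.Countable := by
  have hex : ∀ x : {x ∈ X | T x ≠ leftLimit (fun q => T q) x},
      ∃ r ∈ T x, ∀ q : ℚ, (q : ℝ) < x → r ∉ T q := by
    rintro ⟨x, hx, hne⟩
    by_contra! hc
    refine hne (Subset.antisymm (fun r hr => hc r hr) ?_)
    rintro r ⟨q, hq, hr⟩
    exact hT (hX ⟨q, rfl⟩) hx hq.le hr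
  choose r hr hr' using hex
  have key : ∀ x y : {x ∈ X | T x ≠ leftLimit (fun q => T q) x}, (x : ℝ) < y → r x ≠ r y := by
    intro x y hxy h
    obtain ⟨q, h1, h2⟩ := exists_rat_btwn hxy
    exact hr' y q h2 (h ▸ hT x.2.1 (hX ⟨q, rfl⟩) h1.le (hr x))
  have hinj : Function.Injective r := by
    intro x y h
    by_contra hne
    rcases lt_or_gt_of_ne (fun h => hne (Subtype.ext h) : (x : ℝ) ≠ y) with hlt | hlt
    · exact key x y hlt h
    · exact key y x hlt h.symm
  exact (hinj.countable : Countable _)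

theorem exists_cutSupport_notMem_of_injOn {X P : Set ℝ} (hX : #X = 𝔠) {T : ℝ → Set ℚ}
    (hT : InjOn T X) (hTA : ∀ x ∈ X, T x ∈ intervalAlg univ) {C : Set ℝ} (hC : C.Countable)
    (hP : #P < 𝔠) : ∃ x ∈ X, x ∉ C ∧ x ∉ P ∧ ∃ y ∈ cutSupport (T x), y ∉ P := by
  let P' : Set ℝ := P ∪ range ((↑) : ℚ → ℝ)
  have hP' : #P' < 𝔠 := (mk_union_le _ _).trans_lt (add_lt_of_lt aleph0_le_continuum hP
    ((le_aleph0_iff_set_countable.2 (countable_range _)).trans_lt aleph0_lt_continuum))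
  have : Infinite P' :=
    ((infinite_range_of_injective Rat.cast_injective).mono subset_union_right).to_subtype
  by_contra! hc
  have hsub : X ⊆ (C ∪ P) ∪ {x ∈ X | T x ∈ intervalAlg P'} := by
    intro x hx
    by_contra hn
    simp only [mem_union, mem_ofPred_eq, not_or, not_and] at hn
    obtain ⟨y, hy, hyP⟩ := exists_cutSupport_notMem (hTA x hx) (hn.2 hx)
    exact hyP (Or.inl (hc x hx hn.1.1 hn.1.2 y hy))
  have hsmall : #{x ∈ X | T x ∈ intervalAlg P'} ≤ #(intervalAlg P') :=
    mk_le_of_injective (f := fun x : {x ∈ X | T x ∈ intervalAlg P'} => ⟨T x, x.2.2⟩)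
      fun x y h => Subtype.ext (hT x.2.1 y.2.1 (congrArg Subtype.val h))
  refine (lt_irrefl 𝔠) (hX ▸ (mk_le_mk_of_subset hsub).trans_lt ?_)
  rw [hX]
  refine (mk_union_le _ _).trans_lt (add_lt_of_lt aleph0_le_continuum ?_
    (hsmall.trans_lt ((mk_intervalAlg_le P').trans_lt hP')))
  exact (mk_union_le _ _).trans_lt (add_lt_of_lt aleph0_le_continuum
    ((le_aleph0_iff_set_countable.2 hC).trans_lt aleph0_lt_continuum) hP)

theorem exists_antitone_no_strictMonoOn :
    ∃ X : ℕ → Set ℝ, Antitone X ∧ ∀ n, ¬ ∃ T : ℝ → Set ℚ, StrictMonoOn T (X n) ∧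
      ∀ x ∈ X n, T x ∈ intervalAlg (X (n + 1)) := by
  let J : Type := (ℚ → Set ℚ) × (ℕ → ℝ) × ℕ
  let A : J → ℝ → ℝ → Prop := fun j x y => x ∉ range j.2.1 ∧ y ∈ cutSupport (leftLimit j.1 x)
  let Active : J → Prop := fun j =>
    ∀ P : Set ℝ, #P < 𝔠 → ∃ x y, x ∉ P ∧ y ∉ P ∧ A j x y
  have hJ : #J ≤ 𝔠 := by simp [J, mk_real]
  have hD : #(range ((↑) : ℚ → ℝ)) < 𝔠 :=
    (le_aleph0_iff_set_countable.2 (countable_range _)).trans_lt aleph0_lt_continuum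
  obtain ⟨x, y, hA, hxD, hyD, hinj, hxy⟩ := exists_diagonal_choice hJ
    (fun j x y => Active j → A j x y) _ hD fun j P hP => by
      by_cases hj : Active j
      · obtain ⟨x, y, h1, h2, h3⟩ := hj P hP
        exact ⟨x, y, h1, h2, fun _ => h3⟩
      · obtain ⟨x, hx⟩ : ∃ x, x ∉ P := by
          by_contra! h
          rw [eq_univ_of_forall h, mk_univ, mk_real] at hP
          exact lt_irrefl _ hP
        exact ⟨x, x, hx, hx, fun h => absurd h hj⟩
  let X : ℕ → Set ℝ := fun n => range ((↑) : ℚ → ℝ) ∪ x '' {j | n ≤ j.2.2}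
  have hanti : Antitone X := fun m n hmn =>
    union_subset_union_right _ (image_mono fun j (hj : n ≤ _) => hmn.trans hj)
  refine ⟨X, hanti, fun n ⟨T, hT, hTA⟩ => ?_⟩
  have hcard : #(X n) = 𝔠 := by
    refine le_antisymm ((mk_set_le _).trans_eq mk_real) ?_
    rw [← mk_real]
    refine mk_le_of_injective (f := fun r : ℝ =>
      (⟨x ((fun _ => ∅), (fun _ => r), n), Or.inr ⟨_, le_refl n, rfl⟩⟩ : X n)) fun r s h => ?_
    have := congrArg (fun j : J => j.2.1 0) (hinj (congrArg Subtype.val h))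
    exact this
  let g : ℚ → Set ℚ := fun q => T q
  have hC := countable_ne_leftLimit (subset_union_left : _ ⊆ X n) hT.monotoneOn
  obtain ⟨e, he⟩ := countable_iff_exists_subset_range.1 hC
  let j : J := (g, e, n)
  have hactive : Active j := by
    intro P hP
    obtain ⟨u, huX, hue, huP, v, hv, hvP⟩ := exists_cutSupport_notMem_of_injOn hcard hT.injOn
      (fun u hu => intervalAlg_mono (subset_univ _) (hTA u hu)) (countable_range e) hP
    refine ⟨u, v, huP, hvP, hue, ?_⟩
    have : T u = leftLimit g u := by
      by_contra hne
      exact hue (he ⟨huX, hne⟩)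
    change v ∈ cutSupport (leftLimit g u)
    rwa [← this]
  obtain ⟨hxe, hysupp⟩ := hA j hactive
  have hxX : x j ∈ X n := Or.inr ⟨j, le_refl n, rfl⟩
  have hTx : T (x j) = leftLimit g (x j) := by
    by_contra hne
    exact hxe (he ⟨hxX, hne⟩)
  obtain ⟨F, hF, hcut⟩ := hTA _ hxX
  rw [hTx] at hcut
  rcases hF (hysupp F hcut) with h | ⟨k, hk, hkj⟩
  · exact hyD j h
  · refine hxy j k ?_ hkj
    rintro rfl
    exact Nat.not_succ_le_self n hk

/-- The class modulo finite sets of a set of rationals, under an enumeration of the rationals. -/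
def toPowModFin (S : Set ℚ) : PowModFin :=
  ((fun n => (Denumerable.eqv ℚ).symm n ∈ S : ℕ → Prop) : Filter.Germ Filter.cofinite Prop)

theorem toPowModFin_inter (S T : Set ℚ) :
    toPowModFin (S ∩ T) = toPowModFin S ⊓ toPowModFin T := rfl

theorem toPowModFin_union (S T : Set ℚ) :
    toPowModFin (S ∪ T) = toPowModFin S ⊔ toPowModFin T := rfl

theorem toPowModFin_empty : toPowModFin ∅ = ⊥ := rfl

theorem toPowModFin_univ : toPowModFin univ = ⊤ := rfl

theorem toPowModFin_compl (S : Set ℚ) : toPowModFin Sᶜ = (toPowModFin S)ᶜ := by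
  refine (IsCompl.compl_eq (IsCompl.of_eq ?_ ?_)).symm
  · rw [← toPowModFin_inter, inter_compl_self, toPowModFin_empty]
  · rw [← toPowModFin_union, union_compl_self, toPowModFin_univ]

theorem injOn_toPowModFin : InjOn toPowModFin (intervalAlg univ) := by
  intro S hS T hT h
  refine eq_of_finite_symmDiff hS hT ?_
  have hfin : {n : ℕ | ¬ ((Denumerable.eqv ℚ).symm n ∈ S ↔
      (Denumerable.eqv ℚ).symm n ∈ T)}.Finite :=
    Filter.eventually_cofinite.1 ((Filter.Germ.coe_eq.1 h).mono fun n hn => iff_of_eq hn)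
  refine (hfin.image (Denumerable.eqv ℚ).symm).subset fun q hq => ?_
  exact ⟨Denumerable.eqv ℚ q, by simpa using hq, by simp⟩

theorem isBoolSubalgebra_image_intervalAlg (X : Set ℝ) :
    IsBoolSubalgebra (toPowModFin '' intervalAlg X) := by
  refine ⟨⟨∅, ⟨∅, by simp, fun _ _ _ => Iff.rfl⟩, toPowModFin_empty⟩,
    ⟨univ, ⟨∅, by simp, fun _ _ _ => by simp⟩, toPowModFin_univ⟩, ?_, ?_, ?_⟩
  · rintro _ ⟨S, hS, rfl⟩ _ ⟨T, hT, rfl⟩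
    exact ⟨_, inter_mem_intervalAlg hS hT, toPowModFin_inter S T⟩
  · rintro _ ⟨S, hS, rfl⟩ _ ⟨T, hT, rfl⟩
    exact ⟨_, union_mem_intervalAlg hS hT, toPowModFin_union S T⟩
  · rintro _ ⟨S, hS, rfl⟩
    exact ⟨_, compl_mem_intervalAlg hS, toPowModFin_compl S⟩

theorem strictMono_lowerCut : StrictMono lowerCut := by
  intro x y hxy
  obtain ⟨q, h1, h2⟩ := exists_rat_btwn hxy
  exact (ssubset_iff_of_subset fun _ h => lt_trans h hxy).2 ⟨q, h2, h1.not_gt⟩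

theorem BAEmbeds.exists_strictMonoOn {X Y : Set ℝ}
    (h : BAEmbeds (toPowModFin '' intervalAlg X) (toPowModFin '' intervalAlg Y)) :
    ∃ T : ℝ → Set ℚ, StrictMonoOn T X ∧ ∀ x ∈ X, T x ∈ intervalAlg Y := by
  obtain ⟨f, hmaps, hinj, -, -, hinf, -, -⟩ := h
  have hcut : ∀ x ∈ X, toPowModFin (lowerCut x) ∈ toPowModFin '' intervalAlg X :=
    fun x hx => mem_image_of_mem _ (lowerCut_mem_intervalAlg hx)
  choose! T hTY hT using fun x hx => hmaps (hcut x hx)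
  refine ⟨T, fun x hx y hy hxy => ?_, hTY⟩
  have huniv : ∀ {Z}, intervalAlg Z ⊆ intervalAlg univ :=
    @fun _ => intervalAlg_mono (subset_univ _)
  have hle : T x ∩ T y = T x := by
    refine injOn_toPowModFin (huniv (inter_mem_intervalAlg (hTY x hx) (hTY y hy)))
      (huniv (hTY x hx)) ?_
    rw [toPowModFin_inter, hT x hx, hT y hy, ← hinf _ (hcut x hx) _ (hcut y hy),
      ← toPowModFin_inter, inter_eq_left.2 (strictMono_lowerCut hxy).le]
  refine lt_of_le_of_ne (inter_eq_left.1 hle) fun heq => (strictMono_lowerCut hxy).ne ?_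
  refine injOn_toPowModFin (huniv (lowerCut_mem_intervalAlg hx))
    (huniv (lowerCut_mem_intervalAlg hy)) (hinj (hcut x hx) (hcut y hy) ?_)
  rw [← hT x hx, ← hT y hy, heq]

end

/-- There is a sequence `(B_n)` of Boolean subalgebras of `P(ω)/fin` such that
for every `n`: `B_{n+1}` is a subalgebra of `B_n`, and there is no Boolean
algebra embedding of `B_n` into `B_{n+1}`. -/
theorem descending_chain_of_subalgebras_of_PowModFin :
    ∃ B : ℕ → Set PowModFin,
      (∀ n, IsBoolSubalgebra (B n)) ∧
      (∀ n, B (n + 1) ⊆ B n) ∧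
      (∀ n, ¬ BAEmbeds (B n) (B (n + 1))) := by
  obtain ⟨X, hX, hT⟩ := exists_antitone_no_strictMonoOn
  exact ⟨fun n => toPowModFin '' intervalAlg (X n),
    fun n => isBoolSubalgebra_image_intervalAlg (X n),
    fun n => Set.image_mono (intervalAlg_mono (hX n.le_succ)),
    fun n h => hT n h.exists_strictMonoOn⟩
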